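/- Let T be a triangulated category and S a subcategory of T. Then the subcategories ⟨S⟩_n form an increasing chain ⟨S⟩_0 ⊆ ⟨S⟩_1 ⊆ ⟨S⟩_2 ⊆ ⋯, their union ∪_{n=0}^∞ ⟨S⟩_n is a thick triangulated subcategory of T containing S, and this union equals the smallest thick subcategory ⟨S⟩ of T containing S. -/

import Mathlib

/-!
STATEMENT 8: In a (pre)triangulated category `T`, for a subcategory (identified with its
set of objects) `S`, the subcategories `⟨S⟩_n` form an increasing chain, their union is a
thick triangulated subcategory of `T` containing `S`, and this union equals the smallest
thick subcategory `⟨S⟩` of `T` containing `S`.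
-/

open CategoryTheory Limits Pretriangulated

universe v u

namespace Generation

variable {T : Type u} [Category.{v} T] [HasZeroObject T] [Preadditive T]
  [HasShift T ℤ] [∀ n : ℤ, (shiftFunctor T n).Additive] [Pretriangulated T]

/-- `X` is a retract (direct summand) of `Y`. -/
def IsRetract (X Y : T) : Prop := ∃ (i : X ⟶ Y) (r : Y ⟶ X), i ≫ r = 𝟙 X

/-- The subcategory `⟨S⟩₁`: the smallest full subcategory of `T` containing `S` which is
closed under shifts and under retracts of finite coproducts. -/
inductive ge1 (S : Set T) : T → Prop
  | zero (X : T) (hX : IsZero X) : ge1 S X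
  | shift (X : T) (n : ℤ) (hX : X ∈ S) : ge1 S (X⟦n⟧)
  | coprod (X Y : T) (hX : ge1 S X) (hY : ge1 S Y) (c : BinaryCofan X Y) (hc : IsColimit c) :
      ge1 S c.pt
  | retract (X Y : T) (hY : ge1 S Y) (h : IsRetract X Y) : ge1 S X

/-- The subcategories `⟨S⟩_n`: `⟨S⟩_0 = 0`, `⟨S⟩_1` is as above, and for `n ≥ 2`,
`⟨S⟩_n` consists of the retracts of objects `E` fitting into a distinguished triangle
`A ⟶ E ⟶ B ⟶ A⟦1⟧` with `A ∈ ⟨S⟩_{n-1}` and `B ∈ ⟨S⟩₁`. -/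
def gen (S : Set T) : ℕ → Set T
  | 0 => {X | IsZero X}
  | 1 => {X | ge1 S X}
  | (n + 2) => {X | ∃ Tr : Triangle T, (Tr ∈ distTriang T) ∧ Tr.obj₁ ∈ gen S (n + 1) ∧
      ge1 S Tr.obj₃ ∧ IsRetract X Tr.obj₂}

/-- A set of objects of `T` is a thick (triangulated) subcategory if it contains the zero
objects, is closed under shifts, extensions (two-out-of-three in distinguished triangles)
and retracts. -/
structure IsThickSet (P : Set T) : Prop where
  zero : ∀ X : T, IsZero X → X ∈ P
  shift : ∀ X ∈ P, ∀ n : ℤ, X⟦n⟧ ∈ P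
  ext₂ : ∀ Tr ∈ distTriang T, Tr.obj₁ ∈ P → Tr.obj₃ ∈ P → Tr.obj₂ ∈ P
  ext₃ : ∀ Tr ∈ distTriang T, Tr.obj₁ ∈ P → Tr.obj₂ ∈ P → Tr.obj₃ ∈ P
  ext₁ : ∀ Tr ∈ distTriang T, Tr.obj₂ ∈ P → Tr.obj₃ ∈ P → Tr.obj₁ ∈ P
  retract : ∀ X Y : T, IsRetract X Y → Y ∈ P → X ∈ P

/-- `⟨S⟩`, the smallest thick subcategory of `T` containing `S`. -/
def thick (S : Set T) : Set T := ⋂₀ {P : Set T | IsThickSet P ∧ S ⊆ P}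

end Generation

open Generation

namespace Generation

variable {T : Type u} [Category.{v} T] [HasZeroObject T] [Preadditive T]
  [HasShift T ℤ] [∀ n : ℤ, (shiftFunctor T n).Additive] [Pretriangulated T]

lemma IsRetract.rfl' (X : T) : IsRetract X X := ⟨𝟙 X, 𝟙 X, by simp⟩

lemma IsRetract.trans' {X Y Z : T} (h : IsRetract X Y) (h' : IsRetract Y Z) : IsRetract X Z := by
  obtain ⟨i, r, hi⟩ := h
  obtain ⟨j, s, hj⟩ := h'
  exact ⟨i ≫ j, s ≫ r, by rw [Category.assoc, reassoc_of% hj, hi]⟩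

lemma IsRetract.of_iso {X Y : T} (e : X ≅ Y) : IsRetract X Y := ⟨e.hom, e.inv, by simp⟩

lemma IsRetract.map_shift {X Y : T} (h : IsRetract X Y) (n : ℤ) : IsRetract (X⟦n⟧) (Y⟦n⟧) := by
  obtain ⟨i, r, hi⟩ := h
  exact ⟨i⟦n⟧', r⟦n⟧', by rw [← Functor.map_comp, hi, CategoryTheory.Functor.map_id]⟩

lemma IsRetract.isZero {X Y : T} (h : IsRetract X Y) (hY : IsZero Y) : IsZero X := by
  obtain ⟨i, r, hi⟩ := h
  rw [IsZero.iff_id_eq_zero, ← hi, hY.eq_of_tgt i 0, zero_comp]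

lemma gen_retract (S : Set T) (n : ℕ) {X Y : T} (h : IsRetract X Y) (hY : Y ∈ gen S n) :
    X ∈ gen S n := by
  match n with
  | 0 => exact h.isZero hY
  | 1 => exact ge1.retract X Y hY h
  | n + 2 =>
    obtain ⟨Tr, h1, h2, h3, h4⟩ := hY
    exact ⟨Tr, h1, h2, h3, h.trans' h4⟩

lemma gen_succ (S : Set T) (n : ℕ) : gen S n ⊆ gen S (n + 1) := by
  intro X hX
  match n with
  | 0 => exact ge1.zero X hX
  | n + 1 =>
    exact ⟨contractibleTriangle X, contractible_distinguished X, hX,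
      ge1.zero _ (isZero_zero T), IsRetract.rfl' X⟩

lemma ge1_shift (S : Set T) {X : T} (hX : ge1 S X) (n : ℤ) : ge1 S (X⟦n⟧) := by
  induction hX with
  | zero X hX => exact ge1.zero _ ((shiftFunctor T n).map_isZero hX)
  | shift X m hX =>
    exact ge1.retract _ _ (ge1.shift X (m + n) hX)
      (IsRetract.of_iso ((shiftFunctorAdd T m n).app X).symm)
  | coprod X Y hX hY c hc ihX ihY =>
    have hc' : IsColimit (BinaryCofan.mk c.inl c.inr) :=
      hc.ofIsoColimit (isoBinaryCofanMk c)
    exact ge1.coprod _ _ ihX ihY _ (mapIsColimitOfPreservesOfIsColimit (shiftFunctor T n) _ _ hc')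
  | retract X Y hY h ih => exact ge1.retract _ _ ih (h.map_shift n)

lemma gen_shift (S : Set T) (n : ℕ) (m : ℤ) : ∀ X ∈ gen S n, X⟦m⟧ ∈ gen S n := by
  induction n with
  | zero => exact fun X hX => (shiftFunctor T m).map_isZero hX
  | succ n ih =>
    intro X hX
    match n, ih with
    | 0, _ => exact ge1_shift S hX m
    | n + 1, ih =>
      obtain ⟨Tr, h1, h2, h3, h4⟩ := hX
      exact ⟨_, Triangle.shift_distinguished Tr h1 m, ih _ h2, ge1_shift S h3 m, h4.map_shift m⟩

/-- The morphism `t` factors through an object of `⋃ n, ⟨S⟩_n`. -/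
def Fac (S : Set T) {X Y : T} (t : X ⟶ Y) : Prop :=
  ∃ (n : ℕ) (V : T) (a : X ⟶ V) (e : V ⟶ Y), V ∈ gen S n ∧ a ≫ e = t

/-- A morphism `t : F ⟶ E` which factors through `⋃ n, ⟨S⟩_n` on the kernel of a morphism
`r : F ⟶ B` with `B ∈ ⟨S⟩₁` factors through `⋃ n, ⟨S⟩_n`. -/
lemma fac_one (S : Set T) {F E B : T} (hB : ge1 S B) (t : F ⟶ E) (r : F ⟶ B)
    (h : ∀ (K : T) (k : K ⟶ F), k ≫ r = 0 → Fac S (k ≫ t)) : Fac S t := by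
  obtain ⟨K, k, d, hT⟩ := distinguished_cocone_triangle₁ r
  obtain ⟨n, V, a, e, hV, hae⟩ := h K k (comp_distTriang_mor_zero₁₂ _ hT)
  obtain ⟨V', f', g', hT'⟩ := distinguished_cocone_triangle₂ (d ≫ a⟦(1 : ℤ)⟧')
  have hV' : V' ∈ gen S (n + 2) := ⟨_, hT', gen_succ S n hV, hB, IsRetract.rfl' _⟩
  have hb : ∃ b : F ⟶ V', k ≫ b = a ≫ f' := by
    obtain ⟨b, hb1, _⟩ := complete_distinguished_triangle_morphism₂ _ _ hT hT' a (𝟙 B)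
      (Category.id_comp (d ≫ a⟦(1 : ℤ)⟧')).symm
    exact ⟨b, hb1⟩
  obtain ⟨b, hb1⟩ := hb
  have hz : d ≫ k⟦(1 : ℤ)⟧' = 0 := comp_distTriang_mor_zero₃₁ _ hT
  have hz' : (d ≫ a⟦(1 : ℤ)⟧') ≫ e⟦(1 : ℤ)⟧' = 0 := by
    rw [Category.assoc, ← CategoryTheory.Functor.map_comp, hae,
      CategoryTheory.Functor.map_comp, reassoc_of% hz, zero_comp]
  have he : ∃ e' : V' ⟶ E, f' ≫ e' = e := by
    obtain ⟨e', he1, _⟩ := complete_distinguished_triangle_morphism₂ _ _ hT'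
      (contractible_distinguished E) e 0 (hz'.trans zero_comp.symm)
    exact ⟨e', he1.trans (Category.comp_id e)⟩
  obtain ⟨e', he1⟩ := he
  have hd : k ≫ (t - b ≫ e') = 0 := by
    rw [Preadditive.comp_sub, reassoc_of% hb1, he1, hae, sub_self]
  have hw' : ∃ w : B ⟶ E, t - b ≫ e' = r ≫ w := Triangle.yoneda_exact₂ _ hT (t - b ≫ e') hd
  obtain ⟨w, hw⟩ := hw'
  refine ⟨n + 3, V' ⊞ B, biprod.lift b r, biprod.desc e' w, ?_, ?_⟩
  · exact ⟨_, binaryBiproductTriangle_distinguished V' B, hV', hB, IsRetract.rfl' _⟩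
  · rw [biprod.lift_desc, ← hw]
    abel

lemma fac_gen (S : Set T) (n : ℕ) : ∀ (F E B : T) (_ : B ∈ gen S n) (t : F ⟶ E) (r : F ⟶ B)
    (_ : ∀ (K : T) (k : K ⟶ F), k ≫ r = 0 → Fac S (k ≫ t)), Fac S t := by
  induction n with
  | zero =>
    intro F E B hB t r h
    exact fac_one S (ge1.zero B hB) t r h
  | succ n ih =>
    intro F E B hB t r h
    match n, ih with
    | 0, _ => exact fac_one S hB t r h
    | n + 1, ih =>
      obtain ⟨Tr, hT, h1, h3, i, p, hip⟩ := hB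
      refine fac_one S h3 t (r ≫ i ≫ Tr.mor₂) ?_
      intro K k hk
      obtain ⟨s, hs⟩ := Triangle.coyoneda_exact₂ Tr hT (k ≫ r ≫ i) (by simpa using hk)
      refine ih _ _ _ h1 (k ≫ t) s ?_
      intro L l hl
      rw [← Category.assoc]
      refine h L (l ≫ k) ?_
      have : (l ≫ k) ≫ r ≫ i = 0 := by
        rw [Category.assoc, hs, reassoc_of% hl, zero_comp]
      calc (l ≫ k) ≫ r = ((l ≫ k) ≫ r ≫ i) ≫ p := by simp [hip]
        _ = 0 := by rw [this, zero_comp]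

lemma union_ext₂ (S : Set T) (Tr : Triangle T) (hT : Tr ∈ distTriang T)
    (h1 : Tr.obj₁ ∈ ⋃ n, gen S n) (h3 : Tr.obj₃ ∈ ⋃ n, gen S n) :
    Tr.obj₂ ∈ ⋃ n, gen S n := by
  rw [Set.mem_iUnion] at *
  obtain ⟨m, h1⟩ := h1
  obtain ⟨n, h3⟩ := h3
  obtain ⟨l, V, a, e, hV, hae⟩ := fac_gen S n _ _ _ h3 (𝟙 Tr.obj₂) Tr.mor₂ (by
    intro K k hk
    obtain ⟨s, hs⟩ := Triangle.coyoneda_exact₂ Tr hT k hk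
    exact ⟨m, _, s, Tr.mor₁, h1, by rw [Category.comp_id, hs]⟩)
  exact ⟨l, gen_retract S l ⟨a, e, hae⟩ hV⟩

lemma union_shift (S : Set T) (X : T) (hX : X ∈ ⋃ n, gen S n) (m : ℤ) :
    X⟦m⟧ ∈ ⋃ n, gen S n := by
  rw [Set.mem_iUnion] at *
  obtain ⟨n, hX⟩ := hX
  exact ⟨n, gen_shift S n m X hX⟩

lemma union_thick (S : Set T) : IsThickSet (⋃ n : ℕ, gen S n) where
  zero X hX := Set.mem_iUnion.2 ⟨0, hX⟩
  shift X hX n := union_shift S X hX n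
  ext₂ := union_ext₂ S
  ext₃ Tr hT h1 h2 := union_ext₂ S _ (rot_of_distTriang _ hT) h2 (union_shift S _ h1 1)
  ext₁ Tr hT h2 h3 := union_ext₂ S _ (inv_rot_of_distTriang _ hT) (union_shift S _ h3 (-1)) h2
  retract X Y h hY := by
    rw [Set.mem_iUnion] at *
    obtain ⟨n, hY⟩ := hY
    exact ⟨n, gen_retract S n h hY⟩

lemma subset_union (S : Set T) : S ⊆ ⋃ n : ℕ, gen S n := fun X hX =>
  Set.mem_iUnion.2 ⟨1, ge1.retract _ _ (ge1.shift X 0 hX)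
    (IsRetract.of_iso ((shiftFunctorZero T ℤ).app X).symm)⟩

lemma ge1_mem (S P : Set T) (hP : IsThickSet P) (hS : S ⊆ P) {X : T} (hX : ge1 S X) : X ∈ P := by
  induction hX with
  | zero X hX => exact hP.zero X hX
  | shift X n hX => exact hP.shift X (hS hX) n
  | coprod X Y hX hY c hc ihX ihY =>
    refine hP.retract _ (X ⊞ Y) (IsRetract.of_iso
      (hc.coconePointUniqueUpToIso (BinaryBiproduct.isColimit X Y))) ?_
    exact hP.ext₂ _ (binaryBiproductTriangle_distinguished X Y) ihX ihY
  | retract X Y hY h ih => exact hP.retract X Y h ih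

lemma gen_mem (S P : Set T) (hP : IsThickSet P) (hS : S ⊆ P) (n : ℕ) : gen S n ⊆ P := by
  induction n with
  | zero => exact fun X hX => hP.zero X hX
  | succ n ih =>
    intro X hX
    match n, ih with
    | 0, _ => exact ge1_mem S P hP hS hX
    | n + 1, ih =>
      obtain ⟨Tr, h1, h2, h3, h4⟩ := hX
      exact hP.retract _ _ h4 (hP.ext₂ Tr h1 (ih h2) (ge1_mem S P hP hS h3))

end Generation

theorem statement8 {T : Type u} [Category.{v} T] [HasZeroObject T] [Preadditive T]
    [HasShift T ℤ] [∀ n : ℤ, (shiftFunctor T n).Additive] [Pretriangulated T]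
    (S : Set T) :
    (∀ n : ℕ, gen S n ⊆ gen S (n + 1)) ∧
    IsThickSet (⋃ n : ℕ, gen S n) ∧
    S ⊆ ⋃ n : ℕ, gen S n ∧
    (⋃ n : ℕ, gen S n) = thick S := by
  refine ⟨gen_succ S, union_thick S, subset_union S, Set.Subset.antisymm ?_ ?_⟩
  · exact Set.subset_sInter fun P hP => Set.iUnion_subset fun n => gen_mem S P hP.1 hP.2 n
  · exact Set.sInter_subset_of_mem ⟨union_thick S, subset_union S⟩
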